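/- arXiv:1711.02869 — 2 statements merged into one kernel-verified Lean document; each statement's English description precedes it below -/
import Mathlib

section
/- Let Σ₀ and Σ₁ be D×D real symmetric positive definite matrices and μ₀, μ₁ ∈ ℝ^D, with Gaussian densities p_i(y) = (2π)^{-D/2} (det Σ_i)^{-1/2} exp(−½ (y−μ_i)ᵀ Σ_i⁻¹ (y−μ_i)) for i = 0, 1. Let K = ∫ p₀ log(p₀/p₁) dy. Then ∫_{ℝ^D} p₀(y) (log(p₀(y)/p₁(y)))² dy = ½ trace((Σ₁⁻¹Σ₀ − I)²) + (μ₁−μ₀)ᵀ Σ₁⁻¹ Σ₀ Σ₁⁻¹ (μ₁−μ₀) + K². -/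
open Matrix MeasureTheory

/-- The multivariate normal density on `ℝ^D` with mean `μ` and covariance `S`. -/
noncomputable def gaussianDensity (D : ℕ) (μ : Fin D → ℝ)
    (S : Matrix (Fin D) (Fin D) ℝ) (y : Fin D → ℝ) : ℝ :=
  (2 * Real.pi) ^ (-(D : ℝ) / 2) * S.det ^ (-(1 : ℝ) / 2) *
    Real.exp (-(1 / 2) * ((y - μ) ⬝ᵥ (S⁻¹ *ᵥ (y - μ))))

open ProbabilityTheory

/-- A positive definite matrix and a Hermitian matrix are simultaneously diagonalizable by
congruence. -/
lemma exists_mul_transpose_and_diagonal {n : Type*} [Fintype n] [DecidableEq n]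
    {S T : Matrix n n ℝ} (hS : S.PosDef) (hT : T.IsHermitian) :
    ∃ (A : Matrix n n ℝ) (d : n → ℝ), A.det ≠ 0 ∧ S = A * Aᵀ ∧ Aᵀ * T * A = diagonal d := by
  obtain ⟨B, hB⟩ : ∃ B : Matrix n n ℝ, S = Bᵀ * B := by
    open scoped MatrixOrder in
    obtain ⟨B, hB⟩ := CStarAlgebra.nonneg_iff_eq_star_mul_self.mp hS.posSemidef.nonneg
    exact ⟨B, by rw [hB, star_eq_conjTranspose, conjTranspose_eq_transpose_of_trivial]⟩
  have hdet : B.det ≠ 0 := by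
    intro h
    have := hS.det_pos
    simp [hB, h] at this
  have hM : (B * T * Bᵀ).IsHermitian := by
    simpa [conjTranspose_eq_transpose_of_trivial] using
      isHermitian_mul_mul_conjTranspose B hT
  let U : Matrix n n ℝ := (hM.eigenvectorUnitary : unitaryGroup n ℝ).val
  have hUU : U * Uᵀ = 1 := by
    have := Unitary.coe_mul_star_self hM.eigenvectorUnitary
    rwa [Unitary.coe_star, star_eq_conjTranspose, conjTranspose_eq_transpose_of_trivial] at this
  have hdiag : Uᵀ * (B * T * Bᵀ) * U = diagonal hM.eigenvalues := by
    have := hM.conjStarAlgAut_star_eigenvectorUnitary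
    rw [Unitary.conjStarAlgAut_star_apply, star_eq_conjTranspose,
      conjTranspose_eq_transpose_of_trivial] at this
    simpa [U] using this
  refine ⟨Bᵀ * U, hM.eigenvalues, ?_, ?_, ?_⟩
  · rw [det_mul, det_transpose]
    refine mul_ne_zero hdet fun h => ?_
    have := congrArg det hUU
    simp [h] at this
  · rw [transpose_mul, transpose_transpose, Matrix.mul_assoc, ← Matrix.mul_assoc U, hUU,
      Matrix.one_mul, hB]
  · rw [transpose_mul, transpose_transpose, ← hdiag]
    simp only [Matrix.mul_assoc]

/-- The product of standard Gaussian measures has the product of the densities as density. -/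
lemma pi_gaussianReal_eq_withDensity {ι : Type*} [Fintype ι] :
    Measure.pi (fun _ : ι => gaussianReal 0 1) =
      (volume : Measure (ι → ℝ)).withDensity
        (fun z => ENNReal.ofReal (∏ i, gaussianPDFReal 0 1 (z i))) := by
  refine Measure.pi_eq fun s hs => ?_
  rw [withDensity_apply _ (MeasurableSet.univ_pi hs), volume_pi, Measure.restrict_pi_pi,
    ← ofReal_integral_eq_lintegral_ofReal]
  · rw [integral_fintype_prod_eq_prod, ENNReal.ofReal_prod_of_nonneg]
    · exact Finset.prod_congr rfl fun i _ =>
        (gaussianReal_apply_eq_integral 0 one_ne_zero (s i)).symm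
    · exact fun i _ => integral_nonneg fun x => gaussianPDFReal_nonneg 0 1 x
  · exact Integrable.fintype_prod fun i => (integrable_gaussianPDFReal 0 1).restrict
  · exact .of_forall fun z => Finset.prod_nonneg fun i _ => gaussianPDFReal_nonneg 0 1 _

lemma integral_pi_gaussianReal {ι : Type*} [Fintype ι] (F : (ι → ℝ) → ℝ) :
    ∫ z, F z ∂Measure.pi (fun _ : ι => gaussianReal 0 1) =
      ∫ z : ι → ℝ, (∏ i, gaussianPDFReal 0 1 (z i)) * F z := by
  have hmeas : Measurable fun z : ι → ℝ => ∏ i, gaussianPDFReal 0 1 (z i) :=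
    Finset.measurable_prod _ fun i _ =>
      (measurable_gaussianPDFReal 0 1).comp (measurable_pi_apply i)
  rw [pi_gaussianReal_eq_withDensity, integral_withDensity_eq_integral_toReal_smul
    hmeas.ennreal_ofReal (.of_forall fun _ => ENNReal.ofReal_lt_top)]
  refine integral_congr_ae (.of_forall fun z => ?_)
  simp only [smul_eq_mul]
  rw [ENNReal.toReal_ofReal (Finset.prod_nonneg fun i _ => gaussianPDFReal_nonneg 0 1 _)]

lemma integral_eq_abs_det_mul_integral_mulVec {n : Type*} [Fintype n] [DecidableEq n]
    {A : Matrix n n ℝ} (hA : A.det ≠ 0) (μ : n → ℝ) (g : (n → ℝ) → ℝ) :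
    ∫ y, g y = |A.det| * ∫ z, g (μ + A *ᵥ z) := by
  have hinj : Function.Injective (toLin' A) := by
    have := mulVec_injective_of_isUnit ((isUnit_iff_isUnit_det A).mpr hA.isUnit)
    exact this
  have hemb : MeasurableEmbedding (toLin' A) :=
    (LinearMap.continuous_on_pi (toLin' A)).measurableEmbedding hinj
  have h := hemb.integral_map (μ := volume) (fun y => g (μ + y))
  rw [Real.map_matrix_volume_pi_eq_smul_volume_pi hA, integral_smul_measure,
    ENNReal.toReal_ofReal (abs_nonneg _), integral_add_left_eq_self (fun y => g y)] at h
  simp only [toLin'_apply] at h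
  rw [← h, smul_eq_mul, abs_inv, mul_inv_cancel_left₀ (abs_ne_zero.mpr hA)]

lemma mulVec_dotProduct_inv_mulVec {n : Type*} [Fintype n] [DecidableEq n] {S A : Matrix n n ℝ}
    (hA : A.det ≠ 0) (hS : S = A * Aᵀ) (z : n → ℝ) :
    (A *ᵥ z) ⬝ᵥ (S⁻¹ *ᵥ (A *ᵥ z)) = ∑ i, z i ^ 2 := by
  have hu : IsUnit A.det := hA.isUnit
  have hut : IsUnit Aᵀ.det := by rwa [det_transpose]
  rw [mulVec_mulVec, hS, Matrix.mul_inv_rev, Matrix.mul_assoc, nonsing_inv_mul _ hu, Matrix.mul_one,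
      dotProduct_comm, dotProduct_mulVec, ← mulVec_transpose, mulVec_mulVec,
      mul_nonsing_inv _ hut, one_mulVec]
  simp [dotProduct, sq]

lemma gaussianDensity_add_mulVec {D : ℕ} {μ : Fin D → ℝ} {S A : Matrix (Fin D) (Fin D) ℝ}
    (hA : A.det ≠ 0) (hS : S = A * Aᵀ) (z : Fin D → ℝ) :
    |A.det| * gaussianDensity D μ S (μ + A *ᵥ z) = ∏ i, gaussianPDFReal 0 1 (z i) := by
  have hdet : S.det ^ (-(1 : ℝ) / 2) = |A.det|⁻¹ := by
    rw [hS, det_mul, det_transpose, ← abs_mul_abs_self, ← sq, ← Real.rpow_natCast,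
      ← Real.rpow_mul (abs_nonneg _), ← Real.rpow_neg_one]
    norm_num
  have hpi : (2 * Real.pi) ^ (-(D : ℝ) / 2) = ∏ _i : Fin D, (√(2 * Real.pi))⁻¹ := by
    rw [Finset.prod_const, Finset.card_univ, Fintype.card_fin, Real.sqrt_eq_rpow,
      ← Real.rpow_neg (by positivity), ← Real.rpow_natCast, ← Real.rpow_mul (by positivity)]
    congr 1
    ring
  simp only [gaussianDensity, gaussianPDFReal, add_sub_cancel_left, NNReal.coe_one, mul_one,
    sub_zero]
  rw [mulVec_dotProduct_inv_mulVec hA hS, hdet, Finset.prod_mul_distrib, ← hpi, ← Real.exp_sum,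
    ← Finset.sum_div, Finset.sum_neg_distrib]
  rw [show -(1 / 2) * ∑ i, z i ^ 2 = (-∑ i, z i ^ 2) / 2 by ring]
  field_simp

lemma integral_gaussianDensity_mul {D : ℕ} {μ : Fin D → ℝ} {S A : Matrix (Fin D) (Fin D) ℝ}
    (hA : A.det ≠ 0) (hS : S = A * Aᵀ) (F : (Fin D → ℝ) → ℝ) :
    ∫ y, gaussianDensity D μ S y * F y =
      ∫ z, F (μ + A *ᵥ z) ∂Measure.pi (fun _ : Fin D => gaussianReal 0 1) := by
  rw [integral_pi_gaussianReal, integral_eq_abs_det_mul_integral_mulVec hA μ,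
    ← integral_const_mul]
  refine integral_congr_ae (.of_forall fun z => ?_)
  simp only [← gaussianDensity_add_mulVec (μ := μ) hA hS z, mul_assoc]

lemma log_gaussianDensity {D : ℕ} {S : Matrix (Fin D) (Fin D) ℝ} (hS : S.PosDef) (μ y : Fin D → ℝ) :
    Real.log (gaussianDensity D μ S y) =
      Real.log ((2 * Real.pi) ^ (-(D : ℝ) / 2) * S.det ^ (-(1 : ℝ) / 2)) -
        1 / 2 * ((y - μ) ⬝ᵥ (S⁻¹ *ᵥ (y - μ))) := by
  have := hS.det_pos
  rw [gaussianDensity, Real.log_mul (by positivity) (Real.exp_ne_zero _), Real.log_exp]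
  ring

lemma gaussianDensity_pos {D : ℕ} {S : Matrix (Fin D) (Fin D) ℝ} (hS : S.PosDef)
    (μ y : Fin D → ℝ) : 0 < gaussianDensity D μ S y := by
  have := hS.det_pos
  unfold gaussianDensity
  positivity

/-- In coordinates adapted to both covariances, the log-likelihood ratio of two Gaussian densities
is a sum of univariate quadratic polynomials. -/
lemma exists_log_gaussianDensity_div_eq {D : ℕ} {μ₀ μ₁ : Fin D → ℝ}
    {S₀ S₁ A : Matrix (Fin D) (Fin D) ℝ} {d : Fin D → ℝ} (h₀ : S₀.PosDef) (h₁ : S₁.PosDef)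
    (hA : A.det ≠ 0) (hS : S₀ = A * Aᵀ) (hd : Aᵀ * S₁⁻¹ * A = diagonal d) :
    ∃ c : ℝ, ∀ z : Fin D → ℝ,
      Real.log (gaussianDensity D μ₀ S₀ (μ₀ + A *ᵥ z) / gaussianDensity D μ₁ S₁ (μ₀ + A *ᵥ z)) =
        c + ∑ i, ((d i - 1) / 2 * z i ^ 2 - (Aᵀ *ᵥ (S₁⁻¹ *ᵥ (μ₁ - μ₀))) i * z i) := by
  have hsymm : S₁⁻¹ᵀ = S₁⁻¹ := by
    simpa [conjTranspose_eq_transpose_of_trivial] using h₁.isHermitian.inv.eq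
  have hq₁ (z : Fin D → ℝ) : (A *ᵥ z) ⬝ᵥ (S₁⁻¹ *ᵥ (A *ᵥ z)) = ∑ i, d i * z i ^ 2 := by
    rw [dotProduct_comm, dotProduct_mulVec, ← mulVec_transpose, mulVec_mulVec, mulVec_mulVec,
      hd, dotProduct]
    refine Finset.sum_congr rfl fun i _ => ?_
    rw [mulVec_diagonal]
    ring
  have hlin (z δ : Fin D → ℝ) :
      (A *ᵥ z) ⬝ᵥ (S₁⁻¹ *ᵥ δ) = ∑ i, (Aᵀ *ᵥ (S₁⁻¹ *ᵥ δ)) i * z i := by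
    rw [dotProduct_comm, dotProduct_mulVec, ← mulVec_transpose, dotProduct]
  have hlin' (z δ : Fin D → ℝ) :
      δ ⬝ᵥ (S₁⁻¹ *ᵥ (A *ᵥ z)) = (A *ᵥ z) ⬝ᵥ (S₁⁻¹ *ᵥ δ) := by
    rw [dotProduct_mulVec, ← mulVec_transpose, hsymm, dotProduct_comm]
  set δ := μ₁ - μ₀ with hδ
  refine ⟨Real.log ((2 * Real.pi) ^ (-(D : ℝ) / 2) * S₀.det ^ (-(1 : ℝ) / 2)) -
    Real.log ((2 * Real.pi) ^ (-(D : ℝ) / 2) * S₁.det ^ (-(1 : ℝ) / 2)) +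
    1 / 2 * (δ ⬝ᵥ (S₁⁻¹ *ᵥ δ)), fun z => ?_⟩
  rw [Real.log_div (gaussianDensity_pos h₀ _ _).ne' (gaussianDensity_pos h₁ _ _).ne',
    log_gaussianDensity h₀, log_gaussianDensity h₁, add_sub_cancel_left,
    mulVec_dotProduct_inv_mulVec hA hS,
    show μ₀ + A *ᵥ z - μ₁ = A *ᵥ z - δ by rw [hδ]; abel, mulVec_sub, sub_dotProduct,
    dotProduct_sub, dotProduct_sub, hq₁, hlin', hlin, Finset.sum_sub_distrib]
  have : ∑ i, (d i - 1) / 2 * z i ^ 2 = 1 / 2 * ∑ i, d i * z i ^ 2 - 1 / 2 * ∑ i, z i ^ 2 := by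
    rw [Finset.mul_sum, Finset.mul_sum, ← Finset.sum_sub_distrib]
    exact Finset.sum_congr rfl fun i _ => by ring
  rw [this]
  ring

lemma integral_pow_gaussianReal_eq_iteratedDeriv (n : ℕ) :
    ∫ x, x ^ n ∂gaussianReal 0 1 = iteratedDeriv n (fun t : ℝ => Real.exp (t ^ 2 / 2)) 0 := by
  have h := iteratedDeriv_mgf_zero (X := id) (μ := gaussianReal 0 1)
    (by simp [integrableExpSet_id_gaussianReal]) n
  simp only [mgf_id_gaussianReal, zero_mul, zero_add, NNReal.coe_one, one_mul] at h
  rw [h]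
  simp

lemma deriv_mul_exp_sq_div_two {p p' : ℝ → ℝ} (hp : ∀ t, HasDerivAt p (p' t) t) :
    deriv (fun t => p t * Real.exp (t ^ 2 / 2)) =
      fun t => (p' t + p t * t) * Real.exp (t ^ 2 / 2) := by
  ext t
  have he : HasDerivAt (fun t : ℝ => Real.exp (t ^ 2 / 2)) (Real.exp (t ^ 2 / 2) * t) t := by
    convert ((hasDerivAt_pow 2 t).div_const 2).exp using 1
    simp
  refine ((hp t).fun_mul he).deriv.trans ?_
  ring

lemma moments_gaussianReal :
    ∫ x, x ^ 2 ∂gaussianReal 0 1 = 1 ∧ ∫ x, x ^ 3 ∂gaussianReal 0 1 = 0 ∧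
      ∫ x, x ^ 4 ∂gaussianReal 0 1 = 3 := by
  have d1 : deriv (fun t : ℝ => Real.exp (t ^ 2 / 2)) = fun t => t * Real.exp (t ^ 2 / 2) := by
    simpa using deriv_mul_exp_sq_div_two (p := fun _ => 1) fun t => hasDerivAt_const t 1
  have d2 : deriv (fun t : ℝ => t * Real.exp (t ^ 2 / 2)) =
      fun t => (1 + t * t) * Real.exp (t ^ 2 / 2) :=
    deriv_mul_exp_sq_div_two fun t => hasDerivAt_id t
  have d3 : deriv (fun t : ℝ => (1 + t * t) * Real.exp (t ^ 2 / 2)) =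
      fun t => ((1 * t + t * 1) + (1 + t * t) * t) * Real.exp (t ^ 2 / 2) :=
    deriv_mul_exp_sq_div_two fun t => ((hasDerivAt_id t).mul (hasDerivAt_id t)).const_add 1
  have d4 : deriv (fun t : ℝ => ((1 * t + t * 1) + (1 + t * t) * t) * Real.exp (t ^ 2 / 2)) =
      fun t => ((3 + 3 * t ^ 2) + ((1 * t + t * 1) + (1 + t * t) * t) * t) *
        Real.exp (t ^ 2 / 2) := by
    refine deriv_mul_exp_sq_div_two fun t => ?_
    refine HasDerivAt.congr_deriv ((((hasDerivAt_id' t).const_mul 1).fun_add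
      ((hasDerivAt_id' t).mul_const 1)).fun_add
      ((((hasDerivAt_id' t).fun_mul (hasDerivAt_id' t)).const_add 1).fun_mul
        (hasDerivAt_id' t))) ?_
    ring
  simp only [integral_pow_gaussianReal_eq_iteratedDeriv, iteratedDeriv_succ, iteratedDeriv_zero,
    d1, d2, d3, d4]
  norm_num

lemma integrable_pow_gaussianReal (n : ℕ) : Integrable (fun x : ℝ => x ^ n) (gaussianReal 0 1) := by
  rcases Nat.eq_zero_or_pos n with rfl | hn
  · simp
  · have := (memLp_id_gaussianReal (μ := 0) (v := 1) n).integrable_norm_pow hn.ne'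
    refine this.mono (by fun_prop) (.of_forall fun x => by simp)

lemma memLp_quadratic_gaussianReal (a b : ℝ) :
    MemLp (fun x : ℝ => a * x ^ 2 - b * x) 2 (gaussianReal 0 1) := by
  rw [memLp_two_iff_integrable_sq (by fun_prop)]
  have h := (((integrable_pow_gaussianReal 4).const_mul (a ^ 2)).sub
    ((integrable_pow_gaussianReal 3).const_mul (2 * a * b))).add
    ((integrable_pow_gaussianReal 2).const_mul (b ^ 2))
  refine h.congr (.of_forall fun x => ?_)
  simp only [Pi.add_apply, Pi.sub_apply]
  ring

lemma variance_quadratic_gaussianReal (a b : ℝ) :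
    Var[fun x : ℝ => a * x ^ 2 - b * x; gaussianReal 0 1] = 2 * a ^ 2 + b ^ 2 := by
  obtain ⟨m2, m3, m4⟩ := moments_gaussianReal
  have m1 : ∫ x, b * x ∂gaussianReal 0 1 = 0 := by
    rw [integral_const_mul b fun x => x, integral_id_gaussianReal, mul_zero]
  have i1 : Integrable (fun x : ℝ => x) (gaussianReal 0 1) := by
    simpa using integrable_pow_gaussianReal 1
  have i2 := integrable_pow_gaussianReal 2
  have i3 := integrable_pow_gaussianReal 3
  have i4 := integrable_pow_gaussianReal 4
  rw [variance_eq_sub (memLp_quadratic_gaussianReal a b)]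
  have hsq : ((fun x : ℝ => a * x ^ 2 - b * x) ^ 2) =
      fun x => (a ^ 2 * x ^ 4 - 2 * a * b * x ^ 3) + b ^ 2 * x ^ 2 := by
    ext x
    simp only [Pi.pow_apply]
    ring
  rw [hsq, integral_add (f := fun x => a ^ 2 * x ^ 4 - 2 * a * b * x ^ 3)
      ((i4.const_mul _).sub (i3.const_mul _)) (i2.const_mul _),
    integral_sub (i4.const_mul _) (i3.const_mul _), integral_sub (i2.const_mul _) (i1.const_mul _)]
  simp only [integral_const_mul, m1, m2, m3, m4]
  ring

lemma trace_sq_sub_one_eq_sum {n : Type*} [Fintype n] [DecidableEq n] {A T : Matrix n n ℝ}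
    {d : n → ℝ} (hd : Aᵀ * T * A = diagonal d) :
    ((T * (A * Aᵀ) - 1) ^ 2).trace = ∑ i, (d i - 1) ^ 2 := by
  have h1 : (T * (A * Aᵀ)).trace = ∑ i, d i := by
    rw [← Matrix.mul_assoc, trace_mul_comm, ← Matrix.mul_assoc, hd, trace_diagonal]
  have h2 : (T * (A * Aᵀ) * (T * (A * Aᵀ))).trace = ∑ i, d i * d i := by
    have : T * (A * Aᵀ) * (T * (A * Aᵀ)) = T * A * (Aᵀ * T * A) * Aᵀ := by
      simp only [Matrix.mul_assoc]
    rw [this, trace_mul_comm, ← Matrix.mul_assoc, ← Matrix.mul_assoc Aᵀ T, hd,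
      diagonal_mul_diagonal, trace_diagonal]
  have h3 : (T * (A * Aᵀ) - 1) ^ 2 =
      T * (A * Aᵀ) * (T * (A * Aᵀ)) - T * (A * Aᵀ) - T * (A * Aᵀ) + 1 := by
    noncomm_ring
  rw [h3, trace_add, trace_sub, trace_sub, h1, h2, trace_one, ← Finset.sum_sub_distrib,
    ← Finset.sum_sub_distrib, ← Finset.card_univ, Finset.cast_card, ← Finset.sum_add_distrib]
  exact Finset.sum_congr rfl fun i _ => by ring

/-- Closed form of the variance-type distance `V(p₀,p₁) = E_{p₀}[(log(p₀/p₁))²]`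
between two multivariate Gaussians (proof of Lemma B.1). -/
theorem variance_distance_gaussians
    (D : ℕ) (μ₀ μ₁ : Fin D → ℝ) (S₀ S₁ : Matrix (Fin D) (Fin D) ℝ)
    (h₀ : S₀.PosDef) (h₁ : S₁.PosDef)
    (K : ℝ)
    (hK : K = ∫ y : Fin D → ℝ,
        gaussianDensity D μ₀ S₀ y *
          Real.log (gaussianDensity D μ₀ S₀ y / gaussianDensity D μ₁ S₁ y)) :
    ∫ y : Fin D → ℝ,
        gaussianDensity D μ₀ S₀ y *
          (Real.log (gaussianDensity D μ₀ S₀ y / gaussianDensity D μ₁ S₁ y)) ^ 2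
      = (1 / 2) * ((S₁⁻¹ * S₀ - 1) ^ 2).trace
          + (μ₁ - μ₀) ⬝ᵥ ((S₁⁻¹ * S₀ * S₁⁻¹) *ᵥ (μ₁ - μ₀))
          + K ^ 2 := by
  obtain ⟨A, d, hA, hS, hd⟩ := exists_mul_transpose_and_diagonal h₀ h₁.isHermitian.inv
  obtain ⟨c, hc⟩ := exists_log_gaussianDensity_div_eq (μ₀ := μ₀) (μ₁ := μ₁) h₀ h₁ hA hS hd
  set b := Aᵀ *ᵥ (S₁⁻¹ *ᵥ (μ₁ - μ₀)) with hb
  let X : Fin D → ℝ → ℝ := fun i x => (d i - 1) / 2 * x ^ 2 - b i * x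
  let P : Measure (Fin D → ℝ) := Measure.pi fun _ => gaussianReal 0 1
  have hX (i : Fin D) : MemLp (X i) 2 (gaussianReal 0 1) := memLp_quadratic_gaussianReal _ _
  have hsum : MemLp (∑ i, fun z : Fin D → ℝ => X i (z i)) 2 P :=
    memLp_finsetSum' _ fun i _ => (hX i).comp_measurePreserving (measurePreserving_eval _ i)
  have hL : MemLp (fun z => c + (∑ i, fun z : Fin D → ℝ => X i (z i)) z) 2 P :=
    (memLp_const c).add hsum
  have hvar : Var[fun z => c + (∑ i, fun z : Fin D → ℝ => X i (z i)) z; P] =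
      ∑ i, (2 * ((d i - 1) / 2) ^ 2 + b i ^ 2) := by
    rw [variance_const_add hsum.aestronglyMeasurable, variance_sum_pi hX]
    exact Finset.sum_congr rfl fun i _ => variance_quadratic_gaussianReal _ _
  rw [variance_eq_sub hL] at hvar
  rw [integral_gaussianDensity_mul hA hS fun y =>
    Real.log (gaussianDensity D μ₀ S₀ y / gaussianDensity D μ₁ S₁ y)] at hK
  rw [integral_gaussianDensity_mul hA hS fun y =>
    Real.log (gaussianDensity D μ₀ S₀ y / gaussianDensity D μ₁ S₁ y) ^ 2]
  simp only [hc] at hK ⊢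
  simp only [Pi.pow_apply, Finset.sum_apply, X, P, ← hK] at hvar
  have hbb : (μ₁ - μ₀) ⬝ᵥ ((S₁⁻¹ * S₀ * S₁⁻¹) *ᵥ (μ₁ - μ₀)) = ∑ i, b i ^ 2 := by
    have hsymm : S₁⁻¹ᵀ = S₁⁻¹ := by
      simpa [conjTranspose_eq_transpose_of_trivial] using h₁.isHermitian.inv.eq
    rw [hS, show S₁⁻¹ * (A * Aᵀ) * S₁⁻¹ = S₁⁻¹ * A * (Aᵀ * S₁⁻¹) by simp only [Matrix.mul_assoc],
      ← mulVec_mulVec, ← mulVec_mulVec _ Aᵀ, ← hb, dotProduct_mulVec, ← mulVec_transpose,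
      transpose_mul, hsymm, ← mulVec_mulVec, ← hb]
    simp [dotProduct, sq]
  have htr : (1 / 2) * ((S₁⁻¹ * S₀ - 1) ^ 2).trace = ∑ i, 2 * ((d i - 1) / 2) ^ 2 := by
    rw [hS, trace_sq_sub_one_eq_sum hd, Finset.mul_sum]
    exact Finset.sum_congr rfl fun i _ => by ring
  rw [htr, hbb, ← Finset.sum_add_distrib]
  linarith
end

section
/- Fix D ≥ 2, c₀ > 0 and B > 0. There exists a constant C > 0, depending only on D, c₀ and B, such that for all D×D real lower triangular matrices L₀, L₁ with |L_i j j| ≥ c₀ for all j and |(L_i) j k| ≤ B for all j, k (i = 0, 1), setting Σ_i = L_i L_iᵀ and letting p_i(y) = (2π)^{-D/2} (det Σ_i)^{-1/2} exp(−½ yᵀ Σ_i⁻¹ y) be the centered Gaussian densities, one has ∫_{ℝ^D} p₀(y) (log(p₀(y)/p₁(y)))² dy ≤ C · (max_{j,k} |(L₀) j k − (L₁) j k|)². -/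
open Matrix MeasureTheory

open Finset in
lemma abs_mul_apply_le {D : ℕ} {A B : Matrix (Fin D) (Fin D) ℝ} {a b : ℝ}
    (hA : ∀ i j, |A i j| ≤ a) (hB : ∀ i j, |B i j| ≤ b) (i j : Fin D) :
    |(A * B) i j| ≤ D * (a * b) := by
  rw [Matrix.mul_apply]
  calc |∑ k, A i k * B k j| ≤ ∑ k, |A i k * B k j| := abs_sum_le_sum_abs _ _
    _ ≤ ∑ _k : Fin D, a * b := by
        refine sum_le_sum fun k _ => ?_
        rw [abs_mul]
        exact mul_le_mul (hA i k) (hB k j) (abs_nonneg _) ((abs_nonneg _).trans (hA i k))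
    _ = D * (a * b) := by simp

lemma abs_dotProduct_mulVec_le {D : ℕ} {A : Matrix (Fin D) (Fin D) ℝ} {a : ℝ} (ha : 0 ≤ a)
    (hA : ∀ i j, |A i j| ≤ a) (y : Fin D → ℝ) :
    |y ⬝ᵥ (A *ᵥ y)| ≤ a * (D * ∑ i, y i ^ 2) := by
  have hcs : (∑ i, |y i|) ^ 2 ≤ D * ∑ i, y i ^ 2 := by
    simpa using sq_sum_le_card_mul_sum_sq (s := Finset.univ) (f := fun i => |y i|)
  refine le_trans ?_ (mul_le_mul_of_nonneg_left hcs ha)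
  simp only [dotProduct, mulVec]
  calc |∑ i, y i * ∑ j, A i j * y j| ≤ ∑ i, |y i * ∑ j, A i j * y j| :=
        Finset.abs_sum_le_sum_abs _ _
    _ ≤ ∑ i, |y i| * ∑ j, a * |y j| := by
        refine Finset.sum_le_sum fun i _ => ?_
        rw [abs_mul]
        refine mul_le_mul_of_nonneg_left ?_ (abs_nonneg _)
        refine (Finset.abs_sum_le_sum_abs _ _).trans (Finset.sum_le_sum fun j _ => ?_)
        rw [abs_mul]
        exact mul_le_mul_of_nonneg_right (hA i j) (abs_nonneg _)
    _ = a * (∑ i, |y i|) ^ 2 := by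
        rw [← Finset.mul_sum, ← Finset.sum_mul]; ring

lemma abs_det_eq_prod_of_lower {D : ℕ} {L : Matrix (Fin D) (Fin D) ℝ}
    (hL : ∀ i j, i < j → L i j = 0) : |L.det| = ∏ i, |L i i| := by
  rw [Matrix.det_of_isLowerTriangular (M := L) (fun i j h => hL i j h), Finset.abs_prod]

lemma pow_le_abs_det_of_lower {D : ℕ} {L : Matrix (Fin D) (Fin D) ℝ} {c : ℝ} (hc : 0 < c)
    (hL : ∀ i j, i < j → L i j = 0) (hd : ∀ j, c ≤ |L j j|) : c ^ D ≤ |L.det| := by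
  rw [abs_det_eq_prod_of_lower hL]
  calc c ^ D = ∏ _i : Fin D, c := by simp
    _ ≤ _ := Finset.prod_le_prod (fun _ _ => hc.le) fun i _ => hd i

lemma abs_inv_apply_le {D : ℕ} {L : Matrix (Fin D) (Fin D) ℝ} {c B : ℝ} (hc : 0 < c)
    (hdet : c ≤ |L.det|) (hB : ∀ j k, |L j k| ≤ B) (i j : Fin D) :
    |L⁻¹ i j| ≤ c⁻¹ * (D.factorial * (max B 1) ^ D) := by
  have hadj : |L.adjugate i j| ≤ D.factorial * (max B 1) ^ D := by
    rw [Matrix.adjugate_apply]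
    have := Matrix.det_le (A := L.updateRow j (Pi.single i 1)) (abv := AbsoluteValue.abs)
      (x := max B 1) (fun k l => by
        simp only [AbsoluteValue.abs_apply, Matrix.updateRow_apply, Pi.single_apply]
        split_ifs <;> simp [hB])
    simpa using this
  rw [Matrix.inv_def, Matrix.smul_apply, smul_eq_mul, abs_mul, Ring.inverse_eq_inv', abs_inv]
  exact mul_le_mul (inv_anti₀ hc hdet) hadj (abs_nonneg _) (inv_nonneg.2 hc.le)

lemma inv_mul_transpose_self {D : ℕ} (L : Matrix (Fin D) (Fin D) ℝ) :
    (L * Lᵀ)⁻¹ = L⁻¹ᵀ * L⁻¹ := by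
  rw [Matrix.mul_inv_rev, Matrix.transpose_nonsing_inv]

lemma abs_inv_mul_transpose_sub_le {D : ℕ} {L₀ L₁ : Matrix (Fin D) (Fin D) ℝ} {m δ : ℝ}
    (h₀ : L₀.det ≠ 0) (h₁ : L₁.det ≠ 0)
    (hm₀ : ∀ i j, |L₀⁻¹ i j| ≤ m) (hm₁ : ∀ i j, |L₁⁻¹ i j| ≤ m)
    (hδ : ∀ i j, |L₀ i j - L₁ i j| ≤ δ) (i j : Fin D) :
    |((L₀ * L₀ᵀ)⁻¹ - (L₁ * L₁ᵀ)⁻¹) i j| ≤ 2 * D ^ 3 * m ^ 3 * δ := by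
  have e : L₀⁻¹ - L₁⁻¹ = L₀⁻¹ * (L₁ - L₀) * L₁⁻¹ := by
    rw [mul_sub, sub_mul, Matrix.nonsing_inv_mul _ (isUnit_iff_ne_zero.2 h₀), one_mul,
      Matrix.mul_nonsing_inv_cancel_right _ _ (isUnit_iff_ne_zero.2 h₁)]
  have hd : ∀ i j, |(L₀⁻¹ - L₁⁻¹) i j| ≤ D * (D * (m * δ) * m) := by
    rw [e]
    refine abs_mul_apply_le (abs_mul_apply_le hm₀ fun i j => ?_) hm₁
    rw [Matrix.sub_apply, abs_sub_comm]; exact hδ i j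
  have e' : (L₀ * L₀ᵀ)⁻¹ - (L₁ * L₁ᵀ)⁻¹
      = L₀⁻¹ᵀ * (L₀⁻¹ - L₁⁻¹) + (L₀⁻¹ - L₁⁻¹)ᵀ * L₁⁻¹ := by
    rw [inv_mul_transpose_self, inv_mul_transpose_self, Matrix.transpose_sub, mul_sub, sub_mul]
    abel
  rw [e', Matrix.add_apply]
  refine (abs_add_le _ _).trans ?_
  have a1 := abs_mul_apply_le (A := L₀⁻¹ᵀ) (fun i j => hm₀ j i) hd i j
  have a2 := abs_mul_apply_le (A := (L₀⁻¹ - L₁⁻¹)ᵀ) (fun i j => hd j i) hm₁ i j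
  refine (add_le_add a1 a2).trans (le_of_eq ?_)
  ring

lemma sum_sq_le_mul_quadForm_inv {D : ℕ} {L : Matrix (Fin D) (Fin D) ℝ} {B : ℝ}
    (hL : L.det ≠ 0) (hB : ∀ j k, |L j k| ≤ B) (y : Fin D → ℝ) :
    ∑ i, y i ^ 2 ≤ (D * B) ^ 2 * (y ⬝ᵥ ((L * Lᵀ)⁻¹ *ᵥ y)) := by
  set z := L⁻¹ *ᵥ y with hz
  have hq : y ⬝ᵥ ((L * Lᵀ)⁻¹ *ᵥ y) = ∑ j, z j ^ 2 := by
    rw [inv_mul_transpose_self, ← Matrix.mulVec_mulVec, Matrix.dotProduct_mulVec,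
      Matrix.vecMul_transpose, ← hz]
    simp [dotProduct, sq]
  have hy : L *ᵥ z = y := by
    rw [hz, Matrix.mulVec_mulVec, Matrix.mul_nonsing_inv _ (isUnit_iff_ne_zero.2 hL),
      Matrix.one_mulVec]
  rw [hq]
  have hi : ∀ i, y i ^ 2 ≤ (D * B ^ 2) * ∑ j, z j ^ 2 := fun i => by
    have h1 : y i = ∑ j, L i j * z j := by rw [← hy]; rfl
    rw [h1]
    refine (Finset.sum_mul_sq_le_sq_mul_sq _ _ _).trans ?_
    refine mul_le_mul_of_nonneg_right ?_ (Finset.sum_nonneg fun _ _ => sq_nonneg _)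
    calc ∑ j, L i j ^ 2 ≤ ∑ _j : Fin D, B ^ 2 := Finset.sum_le_sum fun j _ => by
          rw [← sq_abs]; exact pow_le_pow_left₀ (abs_nonneg _) (hB i j) 2
      _ = D * B ^ 2 := by simp
  calc ∑ i, y i ^ 2 ≤ ∑ _i : Fin D, (D * B ^ 2) * ∑ j, z j ^ 2 :=
        Finset.sum_le_sum fun i _ => hi i
    _ = _ := by simp; ring

lemma abs_log_sub_log_le {a b c : ℝ} (hc : 0 < c) (ha : c ≤ a) (hb : c ≤ b) :
    |Real.log a - Real.log b| ≤ |a - b| / c := by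
  have key : ∀ {a b : ℝ}, c ≤ a → c ≤ b → Real.log a - Real.log b ≤ |a - b| / c := by
    intro a b ha hb
    have ha' := hc.trans_le ha
    have hb' := hc.trans_le hb
    rw [← Real.log_div ha'.ne' hb'.ne']
    calc Real.log (a / b) ≤ a / b - 1 := Real.log_le_sub_one_of_pos (by positivity)
      _ = (a - b) / b := by field_simp
      _ ≤ |a - b| / b := by gcongr; exact le_abs_self _
      _ ≤ |a - b| / c := by gcongr
  refine abs_le.2 ⟨?_, key ha hb⟩
  have := key hb ha
  rw [abs_sub_comm] at this
  linarith

lemma abs_log_abs_det_sub_le {D : ℕ} {L₀ L₁ : Matrix (Fin D) (Fin D) ℝ} {c δ : ℝ} (hc : 0 < c)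
    (h₀ : ∀ i j, i < j → L₀ i j = 0) (h₁ : ∀ i j, i < j → L₁ i j = 0)
    (hd₀ : ∀ j, c ≤ |L₀ j j|) (hd₁ : ∀ j, c ≤ |L₁ j j|)
    (hδ : ∀ i j, |L₀ i j - L₁ i j| ≤ δ) :
    |Real.log |L₀.det| - Real.log (|L₁.det|)| ≤ D * (δ / c) := by
  rw [abs_det_eq_prod_of_lower h₀, abs_det_eq_prod_of_lower h₁,
    Real.log_prod (fun i _ => (hc.trans_le (hd₀ i)).ne'),
    Real.log_prod (fun i _ => (hc.trans_le (hd₁ i)).ne'), ← Finset.sum_sub_distrib]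
  calc _ ≤ ∑ i, |Real.log |L₀ i i| - Real.log (|L₁ i i|)| := Finset.abs_sum_le_sum_abs _ _
    _ ≤ ∑ _i : Fin D, δ / c := Finset.sum_le_sum fun i _ =>
        (abs_log_sub_log_le hc (hd₀ i) (hd₁ i)).trans
          (div_le_div_of_nonneg_right ((abs_abs_sub_abs_le _ _).trans (hδ i i)) hc.le)
    _ = _ := by simp

lemma gaussianDensity_mul_transpose {D : ℕ} (L : Matrix (Fin D) (Fin D) ℝ) (y : Fin D → ℝ) :
    gaussianDensity D 0 (L * Lᵀ) y = (2 * Real.pi) ^ (-(D : ℝ) / 2) * |L.det|⁻¹ *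
      Real.exp (-(1 / 2) * (y ⬝ᵥ ((L * Lᵀ)⁻¹ *ᵥ y))) := by
  have : (L * Lᵀ).det ^ (-(1 : ℝ) / 2) = |L.det|⁻¹ := by
    rw [Matrix.det_mul, Matrix.det_transpose, ← sq, neg_div, Real.rpow_neg (sq_nonneg _),
      ← Real.sqrt_eq_rpow, Real.sqrt_sq_eq_abs]
  rw [gaussianDensity, this, sub_zero]

lemma log_gaussianDensity_mul_transpose {D : ℕ} {L : Matrix (Fin D) (Fin D) ℝ} (hL : L.det ≠ 0)
    (y : Fin D → ℝ) :
    Real.log (gaussianDensity D 0 (L * Lᵀ) y) = Real.log ((2 * Real.pi) ^ (-(D : ℝ) / 2))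
      - Real.log |L.det| - 1 / 2 * (y ⬝ᵥ ((L * Lᵀ)⁻¹ *ᵥ y)) := by
  have h2 : (2 * Real.pi) ^ (-(D : ℝ) / 2) ≠ 0 := by positivity
  have h3 : |L.det|⁻¹ ≠ 0 := by positivity
  rw [gaussianDensity_mul_transpose, Real.log_mul (mul_ne_zero h2 h3) (Real.exp_ne_zero _),
    Real.log_mul h2 h3, Real.log_exp, Real.log_inv]
  ring

lemma gaussianDensity_mul_transpose_pos {D : ℕ} {L : Matrix (Fin D) (Fin D) ℝ} (hL : L.det ≠ 0)
    (y : Fin D → ℝ) : 0 < gaussianDensity D 0 (L * Lᵀ) y := by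
  rw [gaussianDensity_mul_transpose]
  positivity

lemma integrable_exp_neg_mul_sum_sq {D : ℕ} {b : ℝ} (hb : 0 < b) :
    Integrable (fun y : Fin D → ℝ => Real.exp (-b * ∑ i, y i ^ 2)) := by
  have := Integrable.fintype_prod (ι := Fin D) (μ := fun _ => (volume : Measure ℝ))
    (f := fun _ (x : ℝ) => Real.exp (-b * x ^ 2)) fun _ => integrable_exp_neg_mul_sq hb
  simpa only [← Real.exp_sum, ← Finset.mul_sum, volume_pi] using this

lemma one_add_sq_mul_exp_neg_le {c s : ℝ} (hc : 0 < c) (hs : 0 ≤ s) :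
    (1 + s) ^ 2 * Real.exp (-(4 * c) * s) ≤ (1 + c⁻¹) ^ 2 * Real.exp (-(2 * c) * s) := by
  have h1 : 1 + s ≤ (1 + c⁻¹) * Real.exp (c * s) := by
    have e1 : 1 ≤ Real.exp (c * s) := Real.one_le_exp (by positivity)
    have e2 : s ≤ c⁻¹ * Real.exp (c * s) := by
      rw [inv_mul_eq_div, le_div_iff₀ hc]
      linarith [Real.add_one_le_exp (c * s)]
    linarith
  calc (1 + s) ^ 2 * Real.exp (-(4 * c) * s)
      ≤ ((1 + c⁻¹) * Real.exp (c * s)) ^ 2 * Real.exp (-(4 * c) * s) := by gcongr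
    _ = (1 + c⁻¹) ^ 2 * (Real.exp (c * s + c * s + -(4 * c) * s)) := by
        rw [Real.exp_add, Real.exp_add]; ring
    _ = _ := by ring_nf

/-- Variance-distance bound `V(p₀,p₁) ≤ C ‖L₀ − L₁‖_∞²` of Lemma B.1. -/
theorem variance_distance_le_of_cholesky_close
    (D : ℕ) (hD : 2 ≤ D) (c₀ B : ℝ) (hc₀ : 0 < c₀) (hB : 0 < B) :
    ∃ C > 0, ∀ L₀ L₁ : Matrix (Fin D) (Fin D) ℝ,
      (∀ i j : Fin D, i < j → L₀ i j = 0) → (∀ i j : Fin D, i < j → L₁ i j = 0) →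
      (∀ j : Fin D, c₀ ≤ |L₀ j j|) → (∀ j : Fin D, c₀ ≤ |L₁ j j|) →
      (∀ j k : Fin D, |L₀ j k| ≤ B) → (∀ j k : Fin D, |L₁ j k| ≤ B) →
      (∫ y : Fin D → ℝ,
          gaussianDensity D 0 (L₀ * L₀ᵀ) y *
            (Real.log (gaussianDensity D 0 (L₀ * L₀ᵀ) y
              / gaussianDensity D 0 (L₁ * L₁ᵀ) y)) ^ 2)
        ≤ C * (⨆ j : Fin D, ⨆ k : Fin D, |L₀ j k - L₁ j k|) ^ 2 := by
  have hD0 : (0 : ℝ) < D := by exact_mod_cast (by omega : 0 < D)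
  obtain ⟨m, hm⟩ : ∃ m : ℝ, m = (c₀ ^ D)⁻¹ * (D.factorial * (max B 1) ^ D) := ⟨_, rfl⟩
  have hm0 : 0 < m := by
    have : 0 < max B 1 := lt_max_of_lt_left hB
    rw [hm]; positivity
  obtain ⟨K, hK⟩ : ∃ K : ℝ, K = D / c₀ + D ^ 4 * m ^ 3 := ⟨_, rfl⟩
  obtain ⟨N, hN⟩ : ∃ N : ℝ, N = (2 * Real.pi) ^ (-(D : ℝ) / 2) * (c₀ ^ D)⁻¹ := ⟨_, rfl⟩
  obtain ⟨c, hc⟩ : ∃ c : ℝ, c = (8 * (D * B) ^ 2)⁻¹ := ⟨_, rfl⟩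
  have hK0 : 0 < K := by rw [hK]; positivity
  have hN0 : 0 < N := by rw [hN]; positivity
  have hc0 : 0 < c := by rw [hc]; positivity
  obtain ⟨I, hI⟩ : ∃ I : ℝ, I = ∫ y : Fin D → ℝ, Real.exp (-(2 * c) * ∑ i, y i ^ 2) := ⟨_, rfl⟩
  have hI0 : 0 ≤ I := by rw [hI]; exact integral_nonneg fun _ => (Real.exp_pos _).le
  refine ⟨N * K ^ 2 * (1 + c⁻¹) ^ 2 * I + 1, by positivity, ?_⟩
  intro L₀ L₁ h₀ h₁ hd₀ hd₁ hB₀ hB₁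
  obtain ⟨δ, hδ⟩ : ∃ δ : ℝ, δ = ⨆ j : Fin D, ⨆ k : Fin D, |L₀ j k - L₁ j k| := ⟨_, rfl⟩
  rw [← hδ]
  have hle : ∀ i j, |L₀ i j - L₁ i j| ≤ δ := fun i j => by
    rw [hδ]
    exact (le_ciSup (f := fun k => |L₀ i k - L₁ i k|) (Set.finite_range _).bddAbove j).trans
      (le_ciSup (f := fun j => ⨆ k, |L₀ j k - L₁ j k|) (Set.finite_range _).bddAbove i)
  have hδ0 : 0 ≤ δ := (abs_nonneg _).trans (hle ⟨0, by omega⟩ ⟨0, by omega⟩)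
  have hcD : 0 < c₀ ^ D := by positivity
  have hdet₀ := pow_le_abs_det_of_lower hc₀ h₀ hd₀
  have hdet₁ := pow_le_abs_det_of_lower hc₀ h₁ hd₁
  have hne₀ : L₀.det ≠ 0 := abs_pos.1 (hcD.trans_le hdet₀)
  have hne₁ : L₁.det ≠ 0 := abs_pos.1 (hcD.trans_le hdet₁)
  have hS := abs_inv_mul_transpose_sub_le hne₀ hne₁
    (fun i j => (abs_inv_apply_le hcD hdet₀ hB₀ i j).trans_eq hm.symm)
    (fun i j => (abs_inv_apply_le hcD hdet₁ hB₁ i j).trans_eq hm.symm) hle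
  have hlog : ∀ y : Fin D → ℝ, |Real.log (gaussianDensity D 0 (L₀ * L₀ᵀ) y
      / gaussianDensity D 0 (L₁ * L₁ᵀ) y)| ≤ K * δ * (1 + ∑ i, y i ^ 2) := fun y => by
    rw [Real.log_div (gaussianDensity_mul_transpose_pos hne₀ y).ne'
      (gaussianDensity_mul_transpose_pos hne₁ y).ne', log_gaussianDensity_mul_transpose hne₀,
      log_gaussianDensity_mul_transpose hne₁]
    have b1 := abs_log_abs_det_sub_le hc₀ h₀ h₁ hd₀ hd₁ hle
    have b2 := abs_dotProduct_mulVec_le (by positivity) hS y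
    rw [Matrix.sub_mulVec, dotProduct_sub] at b2
    have hs : 0 ≤ ∑ i, y i ^ 2 := Finset.sum_nonneg fun _ _ => sq_nonneg _
    generalize ∑ i, y i ^ 2 = s at *
    have b3 : D * (δ / c₀) + D ^ 4 * m ^ 3 * δ * s ≤ K * δ * (1 + s) := by
      have : K * δ * (1 + s) = D * (δ / c₀) + D ^ 4 * m ^ 3 * δ * s
          + (D / c₀ * δ * s + D ^ 4 * m ^ 3 * δ) := by rw [hK]; ring
      rw [this]
      exact le_add_of_nonneg_right (by positivity)
    have b4 : 2 * (D : ℝ) ^ 3 * m ^ 3 * δ * (D * s) = 2 * (D ^ 4 * m ^ 3 * δ * s) := by ring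
    rw [b4] at b2
    rw [abs_le] at b1 b2 ⊢
    constructor <;> linarith [b1.1, b1.2, b2.1, b2.2]
  have hdens : ∀ y : Fin D → ℝ, gaussianDensity D 0 (L₀ * L₀ᵀ) y
      ≤ N * Real.exp (-(4 * c) * ∑ i, y i ^ 2) := fun y => by
    rw [gaussianDensity_mul_transpose, hN]
    have hq := sum_sq_le_mul_quadForm_inv hne₀ hB₀ y
    have hq' : -(1 / 2) * (y ⬝ᵥ ((L₀ * L₀ᵀ)⁻¹ *ᵥ y)) ≤ -(4 * c) * ∑ i, y i ^ 2 := by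
      have h8 : 4 * c * (D * B) ^ 2 = 1 / 2 := by rw [hc]; field_simp; norm_num
      have := mul_le_mul_of_nonneg_left hq (by positivity : 0 ≤ 4 * c)
      rw [← mul_assoc, h8] at this
      linarith
    gcongr
  have hpt : ∀ y : Fin D → ℝ, gaussianDensity D 0 (L₀ * L₀ᵀ) y *
      (Real.log (gaussianDensity D 0 (L₀ * L₀ᵀ) y / gaussianDensity D 0 (L₁ * L₁ᵀ) y)) ^ 2
      ≤ N * K ^ 2 * (1 + c⁻¹) ^ 2 * δ ^ 2 * Real.exp (-(2 * c) * ∑ i, y i ^ 2) := fun y => by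
    have hs : 0 ≤ ∑ i, y i ^ 2 := Finset.sum_nonneg fun _ _ => sq_nonneg _
    have hl : (Real.log (gaussianDensity D 0 (L₀ * L₀ᵀ) y
        / gaussianDensity D 0 (L₁ * L₁ᵀ) y)) ^ 2 ≤ (K * δ * (1 + ∑ i, y i ^ 2)) ^ 2 := by
      rw [← sq_abs]; exact pow_le_pow_left₀ (abs_nonneg _) (hlog y) 2
    refine (mul_le_mul (hdens y) hl (sq_nonneg _) (by positivity)).trans ?_
    have := mul_le_mul_of_nonneg_left (one_add_sq_mul_exp_neg_le hc0 hs)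
      (by positivity : 0 ≤ N * K ^ 2 * δ ^ 2)
    calc _ = N * K ^ 2 * δ ^ 2 * ((1 + ∑ i, y i ^ 2) ^ 2
          * Real.exp (-(4 * c) * ∑ i, y i ^ 2)) := by ring
      _ ≤ _ := this
      _ = _ := by ring
  calc _ ≤ ∫ y : Fin D → ℝ, N * K ^ 2 * (1 + c⁻¹) ^ 2 * δ ^ 2
        * Real.exp (-(2 * c) * ∑ i, y i ^ 2) :=
        integral_mono_of_nonneg
          (.of_forall fun y => mul_nonneg (gaussianDensity_mul_transpose_pos hne₀ y).le
            (sq_nonneg _))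
          ((integrable_exp_neg_mul_sum_sq (by positivity)).const_mul _) (.of_forall hpt)
    _ = N * K ^ 2 * (1 + c⁻¹) ^ 2 * I * δ ^ 2 := by rw [integral_const_mul, ← hI]; ring
    _ ≤ _ := by gcongr; linarith
end
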